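/- Let π be the degree sequence of a tree (a non-increasing sequence of positive integers summing to 2(n−1), where n is its length). A tree G with degree sequence π has greatest spectral radius in the class T_π of all trees with degree sequence π if and only if G admits a BFD-ordering of its vertices. Moreover, such a BFD-ordering is consistent with the Perron vector f of G in the sense that f(u) > f(v) implies u ≺ v. -/

import Mathlib

open Finset

variable {V : Type*} {W : Type*}

/-- The adjacency matrix of a finite simple graph, with real entries. -/
noncomputable def adjMat [Fintype V] (G : SimpleGraph V) : Matrix V V ℝ :=
  letI := Classical.decRel G.Adj
  G.adjMatrix ℝ

/-- The spectral radius `λ(G)`: the largest eigenvalue of the adjacency matrix. -/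
noncomputable def specRad [Fintype V] (G : SimpleGraph V) : ℝ :=
  sSup {μ : ℝ | ∃ f : V → ℝ, f ≠ 0 ∧ (adjMat G).mulVec f = μ • f}

/-- The degree of a vertex. -/
noncomputable def deg [Fintype V] (G : SimpleGraph V) (v : V) : ℕ :=
  letI := Classical.decRel G.Adj
  G.degree v

/-- The degree sequence of `G`, as a multiset. -/
noncomputable def degMultiset [Fintype V] (G : SimpleGraph V) : Multiset ℕ :=
  Finset.univ.val.map (deg G)

/-- `G` has the degree sequence `d` (a sequence of length `n`). -/
def hasDegSeq [Fintype V] (G : SimpleGraph V) {n : ℕ} (d : Fin n → ℕ) : Prop :=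
  Finset.univ.val.map d = degMultiset G

/-- `f` is the Perron vector of `G`: a positive unit eigenvector for the
largest eigenvalue. -/
def IsPerronVector [Fintype V] (G : SimpleGraph V) (f : V → ℝ) : Prop :=
  (∀ v, 0 < f v) ∧ (∑ v, f v ^ 2 = 1) ∧ (adjMat G).mulVec f = specRad G • f

/-- `N_f(v) = Σ_{u ∼ v} f(u)`. -/
noncomputable def Nf [Fintype V] (G : SimpleGraph V) (f : V → ℝ) (v : V) : ℝ :=
  letI := Classical.decRel G.Adj
  ∑ u ∈ G.neighborFinset v, f u

/-- `w` is the parent of `v` w.r.t. the ordering `ord` (with root `ord.symm 0`):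
`w` is the `ord`-least neighbor of `v` whose height is one less than that of `v`. -/
def IsParent [Fintype V] [Nonempty V] (G : SimpleGraph V)
    (ord : V ≃ Fin (Fintype.card V)) (w v : V) : Prop :=
  G.Adj w v ∧ G.dist (ord.symm ⟨0, Fintype.card_pos⟩) w + 1
      = G.dist (ord.symm ⟨0, Fintype.card_pos⟩) v ∧
    ∀ w' : V, G.Adj w' v →
      G.dist (ord.symm ⟨0, Fintype.card_pos⟩) w' + 1
        = G.dist (ord.symm ⟨0, Fintype.card_pos⟩) v → ord w ≤ ord w'

/-- `ord` is a breadth-first search ordering with decreasing degrees (BFD-ordering):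
vertices are listed layer by layer by distance from the root (the `ord`-least vertex),
(B1) children of earlier parents come before children of later parents, and
(B2) earlier vertices have larger or equal degrees. -/
def IsBFDOrdering [Fintype V] [Nonempty V] (G : SimpleGraph V)
    (ord : V ≃ Fin (Fintype.card V)) : Prop :=
  (∀ u v : V, ord u ≤ ord v →
      G.dist (ord.symm ⟨0, Fintype.card_pos⟩) u
        ≤ G.dist (ord.symm ⟨0, Fintype.card_pos⟩) v) ∧
  (∀ w1 w2 v1 v2 : V, ord w1 < ord w2 →
      IsParent G ord w1 v1 → IsParent G ord w2 v2 → ord v1 < ord v2) ∧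
  (∀ u v : V, ord u < ord v → deg G v ≤ deg G u)

/-- A tree degree sequence: non-increasing, positive entries, summing to `2(n-1)`. -/
def IsTreeDegSeq {n : ℕ} (d : Fin n → ℕ) : Prop :=
  Antitone d ∧ (∀ i, 0 < d i) ∧ ∑ i, d i = 2 * (n - 1)

/-- `Σ_{uv ∈ E(G)} f(u) f(v)`. -/
noncomputable def edgeSum [Fintype V] [DecidableEq V] (G : SimpleGraph V) (f : V → ℝ) : ℝ :=
  letI := Classical.decRel G.Adj
  ∑ e ∈ G.edgeFinset, Sym2.lift ⟨fun u v => f u * f v, fun u v => mul_comm (f u) (f v)⟩ e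

/-- The graph obtained from `G` by switching: replacing edges `v1u1`, `v2u2`
by `v1v2`, `u1u2`. -/
noncomputable def switched (G : SimpleGraph V) (v1 u1 v2 u2 : V) : SimpleGraph V :=
  SimpleGraph.fromEdgeSet ((G.edgeSet \ {s(v1, u1), s(v2, u2)}) ∪ {s(v1, v2), s(u1, u2)})

/-- The graph obtained from `G` by shifting: replacing the edge `uv1` by `uv2`. -/
noncomputable def shifted (G : SimpleGraph V) (u v1 v2 : V) : SimpleGraph V :=
  SimpleGraph.fromEdgeSet ((G.edgeSet \ {s(u, v1)}) ∪ {s(u, v2)})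

section Spectral

open Matrix

lemma exists_max_quadForm [Fintype V] [Nonempty V] (A : Matrix V V ℝ) :
    ∃ x : V → ℝ, x ⬝ᵥ x = 1 ∧ ∀ y : V → ℝ, y ⬝ᵥ A *ᵥ y ≤ (x ⬝ᵥ A *ᵥ x) * (y ⬝ᵥ y) := by
  classical
  have hclosed : IsClosed {x : V → ℝ | x ⬝ᵥ x = 1} :=
    isClosed_eq (by fun_prop) continuous_const
  have hbdd : Bornology.IsBounded {x : V → ℝ | x ⬝ᵥ x = 1} := by
    refine (Metric.isBounded_closedBall (x := (0 : V → ℝ)) (r := 1)).subset fun x hx => ?_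
    rw [mem_closedBall_zero_iff, pi_norm_le_iff_of_nonneg zero_le_one]
    intro i
    have h : x i * x i ≤ x ⬝ᵥ x :=
      Finset.single_le_sum (f := fun i => x i * x i) (fun j _ => mul_self_nonneg _)
        (Finset.mem_univ i)
    rw [Set.mem_ofPred_eq.mp hx] at h
    rw [Real.norm_eq_abs]
    exact abs_le_one_iff_mul_self_le_one.mpr h
  have hne : {x : V → ℝ | x ⬝ᵥ x = 1}.Nonempty :=
    ⟨Pi.single (Classical.arbitrary V) 1, by simp⟩
  obtain ⟨x, hx, hmax⟩ := (Metric.isCompact_of_isClosed_isBounded hclosed hbdd).exists_isMaxOn hne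
    (f := fun x : V → ℝ => x ⬝ᵥ A *ᵥ x) (by fun_prop)
  refine ⟨x, hx, fun y => ?_⟩
  by_cases hy : y = 0
  · simp [hy]
  have hpos : 0 < y ⬝ᵥ y :=
    lt_of_le_of_ne (Finset.sum_nonneg fun i _ => mul_self_nonneg _)
      fun h => hy (dotProduct_self_eq_zero.mp h.symm)
  have hs : 0 < √(y ⬝ᵥ y) := Real.sqrt_pos.mpr hpos
  have hss : √(y ⬝ᵥ y) * √(y ⬝ᵥ y) = y ⬝ᵥ y := Real.mul_self_sqrt hpos.le
  have hmem : ((√(y ⬝ᵥ y))⁻¹ • y) ∈ {x : V → ℝ | x ⬝ᵥ x = 1} := by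
    simp only [Set.mem_ofPred_eq, smul_dotProduct, dotProduct_smul, smul_eq_mul]
    field_simp
    rw [sq, hss]
  have h := hmax hmem
  simp only [Set.mem_ofPred_eq, smul_dotProduct, mulVec_smul, dotProduct_smul, smul_eq_mul] at h
  rw [← mul_assoc, ← mul_inv, hss, inv_mul_le_iff₀ hpos] at h
  linarith

lemma mulVec_eq_smul_of_quadForm_max [Fintype V] {A : Matrix V V ℝ} (hA : A.IsHermitian) {M : ℝ}
    (hM : ∀ y : V → ℝ, y ⬝ᵥ A *ᵥ y ≤ M * (y ⬝ᵥ y)) {x : V → ℝ}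
    (hx : x ⬝ᵥ A *ᵥ x = M * (x ⬝ᵥ x)) : A *ᵥ x = M • x := by
  classical
  have hps : (M • (1 : Matrix V V ℝ) - A).PosSemidef := by
    refine PosSemidef.of_dotProduct_mulVec_nonneg ?_ fun y => ?_
    · refine IsHermitian.sub ?_ hA
      simp [IsHermitian]
    · have := hM y
      simp only [star_trivial, sub_mulVec, smul_mulVec, one_mulVec, dotProduct_sub,
        dotProduct_smul, smul_eq_mul]
      linarith
  have h0 := (hps.dotProduct_mulVec_zero_iff x).mp (by
    simp only [star_trivial, sub_mulVec, smul_mulVec, one_mulVec, dotProduct_sub,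
        dotProduct_smul, smul_eq_mul]
    linarith)
  rw [sub_mulVec, smul_mulVec, one_mulVec, sub_eq_zero] at h0
  exact h0.symm

lemma adjMat_isHermitian [Fintype V] (G : SimpleGraph V) : (adjMat G).IsHermitian := by
  classical
  ext i j
  simp [adjMat, SimpleGraph.adj_comm]

lemma adjMat_nonneg [Fintype V] (G : SimpleGraph V) (u v : V) : 0 ≤ adjMat G u v := by
  classical
  simp only [adjMat, SimpleGraph.adjMatrix_apply]
  split_ifs <;> norm_num

lemma exists_quadForm_eq_specRad [Fintype V] [Nonempty V] (G : SimpleGraph V) :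
    ∃ x : V → ℝ, x ⬝ᵥ x = 1 ∧ x ⬝ᵥ adjMat G *ᵥ x = specRad G ∧
      (∀ y : V → ℝ, y ⬝ᵥ adjMat G *ᵥ y ≤ specRad G * (y ⬝ᵥ y)) := by
  obtain ⟨x, hx, hmax⟩ := exists_max_quadForm (adjMat G)
  have hA := mulVec_eq_smul_of_quadForm_max (adjMat_isHermitian G) hmax (x := x) (by rw [hx, mul_one])
  have hS : specRad G = x ⬝ᵥ adjMat G *ᵥ x := by
    refine IsGreatest.csSup_eq ⟨⟨x, ?_, hA⟩, ?_⟩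
    · rintro rfl
      simp at hx
    · rintro μ ⟨g, hg, hgμ⟩
      have hpos : 0 < g ⬝ᵥ g :=
        lt_of_le_of_ne (Finset.sum_nonneg fun i _ => mul_self_nonneg _)
          fun h => hg (dotProduct_self_eq_zero.mp h.symm)
      have := hmax g
      rw [hgμ, dotProduct_smul, smul_eq_mul] at this
      exact le_of_mul_le_mul_right this hpos
  exact ⟨x, hx, hS.symm, hS ▸ hmax⟩

lemma quadForm_le_specRad [Fintype V] [Nonempty V] (G : SimpleGraph V) (y : V → ℝ) :
    y ⬝ᵥ adjMat G *ᵥ y ≤ specRad G * (y ⬝ᵥ y) := by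
  obtain ⟨_, _, _, h⟩ := exists_quadForm_eq_specRad G
  exact h y

lemma exists_isPerronVector [Fintype V] (G : SimpleGraph V) (hG : G.Connected) :
    ∃ f, IsPerronVector G f := by
  classical
  have := hG.nonempty
  obtain ⟨x, hx, hxS, hmax⟩ := exists_quadForm_eq_specRad G
  have habs : |x| ⬝ᵥ |x| = 1 := by
    rw [← hx]
    simp [dotProduct, abs_mul_abs_self]
  have hle : x ⬝ᵥ adjMat G *ᵥ x ≤ |x| ⬝ᵥ adjMat G *ᵥ |x| := by
    simp only [dotProduct, mulVec, Finset.mul_sum]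
    refine Finset.sum_le_sum fun i _ => Finset.sum_le_sum fun j _ => ?_
    refine (le_abs_self _).trans ?_
    rw [abs_mul, abs_mul, abs_of_nonneg (adjMat_nonneg G i j)]
    rfl
  have hA : adjMat G *ᵥ |x| = specRad G • |x| :=
    mulVec_eq_smul_of_quadForm_max (adjMat_isHermitian G) hmax
      (le_antisymm (hmax _) (by rw [habs, mul_one, ← hxS]; exact hle))
  have hprop : ∀ u v, G.Adj u v → |x| u = 0 → |x| v = 0 := by
    intro u v huv hu
    have h := congrFun hA u
    rw [Pi.smul_apply, hu, smul_zero] at h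
    have h0 := (Finset.sum_eq_zero_iff_of_nonneg (fun j _ =>
      mul_nonneg (adjMat_nonneg G u j) (abs_nonneg (x j)))).mp h v (Finset.mem_univ v)
    simpa [adjMat, huv] using h0
  have hwalk : ∀ u v, G.Walk u v → |x| u = 0 → |x| v = 0 := by
    intro u v p
    induction p with
    | nil => exact id
    | cons h _ ih => exact fun hu => ih (hprop _ _ h hu)
  refine ⟨|x|, fun v => lt_of_le_of_ne (abs_nonneg (x v)) fun hv => ?_, ?_, hA⟩
  · have hz : |x| = 0 := funext fun w => hwalk v w (hG v w).some hv.symm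
    rw [hz] at habs
    simp at habs
  · rw [← habs]
    simp [dotProduct, sq]

lemma Nf_eq_mulVec [Fintype V] (G : SimpleGraph V) (f : V → ℝ) : adjMat G *ᵥ f = Nf G f := by
  classical
  ext v
  simp [adjMat, Nf]

lemma deg_eq_Nf_one [Fintype V] (G : SimpleGraph V) (v : V) : (deg G v : ℝ) = Nf G 1 v := by
  simp [deg, Nf]

lemma specRad_lt_of_dotProduct_Nf_le [Fintype V] [Nonempty V] {G H : SimpleGraph V} {f : V → ℝ}
    (hf : IsPerronVector G f) (hle : f ⬝ᵥ Nf G f ≤ f ⬝ᵥ Nf H f) {v : V} (hv : Nf G f v ≠ Nf H f v) :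
    specRad G < specRad H := by
  obtain ⟨-, hunit, heig⟩ := hf
  have h1 : f ⬝ᵥ f = 1 := by simpa [dotProduct, sq] using hunit
  have hQ : f ⬝ᵥ Nf G f = specRad G := by
    rw [← Nf_eq_mulVec, heig, dotProduct_smul, h1, smul_eq_mul, mul_one]
  have hH := quadForm_le_specRad H f
  rw [h1, mul_one, Nf_eq_mulVec] at hH
  refine lt_of_le_of_ne (hQ ▸ hle.trans hH) fun heq => hv ?_
  have := mulVec_eq_smul_of_quadForm_max (adjMat_isHermitian H) (quadForm_le_specRad H) (x := f) (by
    rw [h1, mul_one, Nf_eq_mulVec]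
    exact le_antisymm hH (by rw [← heq, ← hQ]; exact hle))
  rw [← Nf_eq_mulVec, ← Nf_eq_mulVec, heig, this, heq]

lemma specRad_le_of_iso [Fintype V] [Nonempty V] {G H : SimpleGraph V} (e : G ≃g H)
    {f : V → ℝ} (hf : IsPerronVector H f) : specRad H ≤ specRad G := by
  classical
  have hA : adjMat G = (adjMat H).submatrix e e := by
    ext u v
    simp [adjMat, SimpleGraph.adjMatrix_apply, e.map_adj_iff]
  have h1 : f ⬝ᵥ f = 1 := by simpa [dotProduct, sq] using hf.2.1
  have h := quadForm_le_specRad G (f ∘ e)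
  have hmul : adjMat G *ᵥ (f ∘ e) = (adjMat H *ᵥ f) ∘ e := by
    rw [hA]
    have := submatrix_mulVec_equiv (adjMat H) (f ∘ e) e e.toEquiv
    rw [show (f ∘ e) ∘ e.toEquiv.symm = f from
      funext fun v => congrArg f (e.toEquiv.apply_symm_apply v)] at this
    exact this
  have hcomp : ∀ g k : V → ℝ, (g ∘ e) ⬝ᵥ (k ∘ e) = g ⬝ᵥ k := fun g k =>
    Equiv.sum_comp e.toEquiv (fun i => g i * k i)
  rw [hmul, hcomp, hcomp, hf.2.2, dotProduct_smul, h1] at h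
  simpa using h

end Spectral

section Surgery

open Matrix

lemma Nf_eq_sum_ite [Fintype V] (G : SimpleGraph V) [DecidableRel G.Adj] (g : V → ℝ) (x : V) :
    Nf G g x = ∑ y, if G.Adj x y then g y else 0 := by
  rw [Nf, ← Finset.sum_filter]
  congr 1
  ext y
  simp

lemma Nf_switched [Fintype V] [DecidableEq V] {G : SimpleGraph V} {a b c d : V}
    (hab : G.Adj a b) (hcd : G.Adj c d) (hac : a ≠ c) (hbd : b ≠ d) (hac' : ¬ G.Adj a c)
    (hbd' : ¬ G.Adj b d) (g : V → ℝ) (x : V) :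
    Nf (switched G a b c d) g x = Nf G g x + (if x = a then g c - g b else 0)
      + (if x = b then g d - g a else 0) + (if x = c then g a - g d else 0)
      + (if x = d then g b - g c else 0) := by
  classical
  have hbc : b ≠ c := fun h => hac' (h ▸ hab)
  have had : a ≠ d := fun h => hac' (h ▸ hcd.symm)
  have hab' := hab.ne
  have hcd' := hcd.ne
  have key : ∀ y, (if (switched G a b c d).Adj x y then g y else 0) =
      (if G.Adj x y then g y else 0)
        + (if y = c then (if x = a then g c else 0) else 0)
        - (if y = b then (if x = a then g b else 0) else 0)
        + (if y = d then (if x = b then g d else 0) else 0)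
        - (if y = a then (if x = b then g a else 0) else 0)
        + (if y = a then (if x = c then g a else 0) else 0)
        - (if y = d then (if x = c then g d else 0) else 0)
        + (if y = b then (if x = d then g b else 0) else 0)
        - (if y = c then (if x = d then g c else 0) else 0) := by
    intro y
    have hadj : (switched G a b c d).Adj x y ↔
        (G.Adj x y ∧ ¬ (x = a ∧ y = b) ∧ ¬ (x = b ∧ y = a) ∧ ¬ (x = c ∧ y = d) ∧ ¬ (x = d ∧ y = c))
        ∨ (x = a ∧ y = c) ∨ (x = c ∧ y = a) ∨ (x = b ∧ y = d) ∨ (x = d ∧ y = b) := by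
      simp only [switched, SimpleGraph.fromEdgeSet_adj, Set.mem_union, Set.mem_sdiff,
        SimpleGraph.mem_edgeSet, Set.mem_insert_iff, Set.mem_singleton_iff, Sym2.eq_iff]
      have := G.ne_of_adj (a := x) (b := y)
      grind
    simp only [hadj]
    have hba := hab.symm
    have hdc := hcd.symm
    have hca' : ¬ G.Adj c a := fun h => hac' h.symm
    have hdb' : ¬ G.Adj d b := fun h => hbd' h.symm
    have hba' := hab.ne'
    have hdc' := hcd.ne'
    have hca := hac.symm
    have hdb := hbd.symm
    by_cases hxa : x = a
    · subst hxa
      by_cases hyb : y = b <;> by_cases hyc : y = c <;> simp_all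
    by_cases hxb : x = b
    · subst hxb
      by_cases hyb : y = a <;> by_cases hyc : y = d <;> simp_all
    by_cases hxc : x = c
    · subst hxc
      by_cases hyb : y = a <;> by_cases hyc : y = d <;> simp_all
    by_cases hxd : x = d
    · subst hxd
      by_cases hyb : y = b <;> by_cases hyc : y = c <;> simp_all
    simp [hxa, hxb, hxc, hxd]
  rw [Nf_eq_sum_ite, Nf_eq_sum_ite, Finset.sum_congr rfl fun y _ => key y]
  simp only [Finset.sum_add_distrib, Finset.sum_sub_distrib, Finset.sum_ite_eq',
    Finset.mem_univ, if_true]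
  split_ifs <;> ring

lemma degMultiset_switched [Fintype V] [DecidableEq V] {G : SimpleGraph V} {a b c d : V}
    (hab : G.Adj a b) (hcd : G.Adj c d) (hac : a ≠ c) (hbd : b ≠ d) (hac' : ¬ G.Adj a c)
    (hbd' : ¬ G.Adj b d) : degMultiset (switched G a b c d) = degMultiset G := by
  refine congrArg (fun k => Finset.univ.val.map k) (funext fun v => ?_)
  have h : (deg (switched G a b c d) v : ℝ) = deg G v := by
    rw [deg_eq_Nf_one, deg_eq_Nf_one, Nf_switched hab hcd hac hbd hac' hbd']
    simp
  exact_mod_cast h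

lemma specRad_lt_specRad_switched [Fintype V] [DecidableEq V] [Nonempty V] {G : SimpleGraph V}
    {a b c d : V} (hab : G.Adj a b) (hcd : G.Adj c d) (hac : a ≠ c) (hbd : b ≠ d)
    (hac' : ¬ G.Adj a c) (hbd' : ¬ G.Adj b d) {f : V → ℝ} (hf : IsPerronVector G f)
    (hda : f d ≤ f a) (hbc : f b < f c) : specRad G < specRad (switched G a b c d) := by
  have hN := Nf_switched hab hcd hac hbd hac' hbd' f
  refine specRad_lt_of_dotProduct_Nf_le hf (v := a) ?_ ?_
  · have : f ⬝ᵥ Nf (switched G a b c d) f = f ⬝ᵥ Nf G f + 2 * ((f a - f d) * (f c - f b)) := by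
      simp only [dotProduct, hN, mul_add, Finset.sum_add_distrib, mul_ite, mul_zero,
        Finset.sum_ite_eq', Finset.mem_univ, if_true]
      ring
    rw [this]
    nlinarith [mul_nonneg (sub_nonneg.mpr hda) (sub_pos.mpr hbc).le]
  · have had : a ≠ d := fun h => hac' (h ▸ hcd.symm)
    rw [hN a]
    simp only [if_true, if_neg hab.ne, if_neg hac, if_neg had]
    intro h
    linarith

/-- The graph obtained from `G` by replacing the edges `us` with `vs`, for all `s ∈ S`. -/
def shiftedSet (G : SimpleGraph V) (u v : V) (S : Finset V) (hv : v ∉ S) : SimpleGraph V where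
  Adj x y := (G.Adj x y ∧ ¬ (x = u ∧ y ∈ S) ∧ ¬ (y = u ∧ x ∈ S)) ∨ (x = v ∧ y ∈ S) ∨ (y = v ∧ x ∈ S)
  symm := ⟨fun x y h => by have := G.adj_comm x y; grind⟩
  loopless := ⟨fun x h => by have := G.loopless.irrefl x; grind⟩

lemma Nf_shiftedSet [Fintype V] [DecidableEq V] {G : SimpleGraph V} {u v : V} {S : Finset V}
    (hv : v ∉ S) (huv : u ≠ v) (hu : ∀ s ∈ S, G.Adj u s) (hvS : ∀ s ∈ S, ¬ G.Adj v s)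
    (g : V → ℝ) (x : V) :
    Nf (shiftedSet G u v S hv) g x = Nf G g x + (if x = v then ∑ s ∈ S, g s else 0)
      - (if x = u then ∑ s ∈ S, g s else 0) + (if x ∈ S then g v - g u else 0) := by
  classical
  have key : ∀ y, (if (shiftedSet G u v S hv).Adj x y then g y else 0) =
      (if G.Adj x y then g y else 0)
        + (if y ∈ S then (if x = v then g y else 0) else 0)
        - (if y ∈ S then (if x = u then g y else 0) else 0)
        + (if y = v then (if x ∈ S then g v else 0) else 0)
        - (if y = u then (if x ∈ S then g u else 0) else 0) := by
    intro y
    have huS : u ∉ S := fun h => G.loopless.irrefl u (hu u h)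
    have h1 := hu x
    have h2 := hu y
    have h3 := hvS x
    have h4 := hvS y
    have h5 := G.adj_comm x y
    simp only [shiftedSet]
    by_cases hxu : x = u
    · subst hxu
      by_cases hy : y ∈ S <;> simp_all
    by_cases hxv : x = v
    · subst hxv
      by_cases hy : y ∈ S <;> simp_all
    by_cases hx : x ∈ S
    · by_cases hyu : y = u
      · subst hyu
        simp_all
      · by_cases hyv : y = v
        · subst hyv
          simp_all
        · simp_all
    · simp [hx, hxu, hxv]
  rw [Nf_eq_sum_ite, Nf_eq_sum_ite, Finset.sum_congr rfl fun y _ => key y]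
  simp only [Finset.sum_add_distrib, Finset.sum_sub_distrib, Finset.sum_ite_eq',
    Finset.mem_univ, if_true, Finset.sum_ite_mem, Finset.univ_inter]
  split_ifs <;> simp <;> ring

lemma degMultiset_shiftedSet [Fintype V] [DecidableEq V] {G : SimpleGraph V} {u v : V}
    {S : Finset V} (hv : v ∉ S) (huv : u ≠ v) (hu : ∀ s ∈ S, G.Adj u s)
    (hvS : ∀ s ∈ S, ¬ G.Adj v s) (hcard : deg G u = deg G v + S.card) :
    degMultiset (shiftedSet G u v S hv) = degMultiset G := by
  have hdeg : ∀ x, deg (shiftedSet G u v S hv) x = deg G (Equiv.swap u v x) := by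
    intro x
    have huS : u ∉ S := fun h => G.loopless.irrefl u (hu u h)
    have hcard' : (deg G u : ℝ) = deg G v + S.card := by exact_mod_cast hcard
    have h : (deg (shiftedSet G u v S hv) x : ℝ) = deg G (Equiv.swap u v x) := by
      rw [deg_eq_Nf_one, Nf_shiftedSet hv huv hu hvS, ← deg_eq_Nf_one]
      by_cases hxu : x = u
      · subst hxu
        simp [huv, hcard']
      by_cases hxv : x = v
      · subst hxv
        simp [hxu, hcard']
      simp [hxu, hxv, Equiv.swap_apply_of_ne_of_ne]
    exact_mod_cast h
  have : deg (shiftedSet G u v S hv) = deg G ∘ Equiv.swap u v := funext hdeg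
  rw [degMultiset, degMultiset, this, ← Multiset.map_map, Multiset.map_univ_val_equiv]

lemma specRad_lt_specRad_shiftedSet [Fintype V] [DecidableEq V] [Nonempty V] {G : SimpleGraph V}
    {u v : V} {S : Finset V} (hv : v ∉ S) (huv : u ≠ v) (hu : ∀ s ∈ S, G.Adj u s)
    (hvS : ∀ s ∈ S, ¬ G.Adj v s) (hS : S.Nonempty) {f : V → ℝ} (hf : IsPerronVector G f)
    (hle : f u ≤ f v) : specRad G < specRad (shiftedSet G u v S hv) := by
  have hN := Nf_shiftedSet hv huv hu hvS f
  have hpos : 0 < ∑ s ∈ S, f s := Finset.sum_pos (fun s _ => hf.1 s) hS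
  refine specRad_lt_of_dotProduct_Nf_le hf (v := v) ?_ ?_
  · have : f ⬝ᵥ Nf (shiftedSet G u v S hv) f =
        f ⬝ᵥ Nf G f + 2 * ((f v - f u) * ∑ s ∈ S, f s) := by
      simp only [dotProduct, hN, mul_add, mul_sub, Finset.sum_add_distrib,
        Finset.sum_sub_distrib, mul_ite, mul_zero, Finset.sum_ite_eq', Finset.mem_univ, if_true,
        Finset.sum_ite_mem, Finset.univ_inter, ← Finset.sum_mul]
      ring
    rw [this]
    nlinarith [mul_nonneg (sub_nonneg.mpr hle) hpos.le]
  · rw [hN v]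
    simp only [if_true, if_neg huv.symm, if_neg hv]
    intro h
    linarith

end Surgery

section Rooting

lemma SimpleGraph.IsTree.eq_of_adj_of_dist_eq {G : SimpleGraph V} (hG : G.IsTree) {r u w v : V}
    (hu : G.Adj u v) (hw : G.Adj w v) (hdu : G.dist r u + 1 = G.dist r v)
    (hdw : G.dist r w + 1 = G.dist r v) : u = w := by
  obtain ⟨p, hp⟩ := hG.connected.exists_walk_length_eq_dist r u
  obtain ⟨q, hq⟩ := hG.connected.exists_walk_length_eq_dist r w
  have hp' : (p.concat hu).IsPath :=
    (p.concat hu).isPath_of_length_eq_dist (by rw [SimpleGraph.Walk.length_concat, hp, hdu])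
  have hq' : (q.concat hw).IsPath :=
    (q.concat hw).isPath_of_length_eq_dist (by rw [SimpleGraph.Walk.length_concat, hq, hdw])
  have h := congrArg (fun p : G.Path r v => p.1.penultimate)
    ((hG.isAcyclic.subsingleton_path r v).elim ⟨_, hp'⟩ ⟨_, hq'⟩)
  simpa using h

lemma SimpleGraph.Connected.exists_adj_dist_add_one {G : SimpleGraph V} (hG : G.Connected)
    {r v : V} (hv : v ≠ r) : ∃ u, G.Adj v u ∧ G.dist r u + 1 = G.dist r v := by
  obtain ⟨p, hp⟩ := hG.exists_walk_length_eq_dist v r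
  cases p with
  | nil => exact absurd rfl hv
  | cons h q =>
    rename_i u
    refine ⟨u, h, ?_⟩
    have h1 := SimpleGraph.dist_le q
    have h2 := hG.dist_triangle (u := v) (v := u) (w := r)
    rw [SimpleGraph.dist_eq_one_iff_adj.mpr h] at h2
    rw [SimpleGraph.Walk.length_cons] at hp
    rw [SimpleGraph.dist_comm (u := r), SimpleGraph.dist_comm (u := r)]
    omega

/-- `par` assigns to each vertex of the tree `G` rooted at `r` its parent, and `r` to `r`. -/
structure IsParentMap (G : SimpleGraph V) (r : V) (par : V → V) : Prop where
  root : par r = r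
  adj : ∀ {v}, v ≠ r → G.Adj v (par v)
  dist : ∀ {v}, v ≠ r → G.dist r (par v) + 1 = G.dist r v
  eq_or_eq : ∀ {u v}, G.Adj u v → par u = v ∨ par v = u

lemma SimpleGraph.IsTree.exists_isParentMap {G : SimpleGraph V} (hG : G.IsTree) (r : V) :
    ∃ par, IsParentMap G r par := by
  classical
  choose! p hp using fun v (hv : v ≠ r) => hG.connected.exists_adj_dist_add_one (r := r) hv
  have hne : ∀ {v u}, G.dist r u + 1 = G.dist r v → v ≠ r := by
    rintro v u h rfl
    rw [SimpleGraph.dist_self] at h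
    omega
  refine ⟨fun v => if v = r then r else p v, if_pos rfl, ?_, ?_, ?_⟩
  · intro v hv
    rw [if_neg hv]
    exact (hp v hv).1
  · intro v hv
    rw [if_neg hv]
    exact (hp v hv).2
  · intro u v huv
    rcases hG.dist_eq_dist_add_one_of_adj r huv with h | h
    · left
      rw [if_neg (hne h.symm)]
      exact hG.eq_of_adj_of_dist_eq (hp u (hne h.symm)).1.symm huv.symm (hp u (hne h.symm)).2 h.symm
    · right
      rw [if_neg (hne h.symm)]
      exact hG.eq_of_adj_of_dist_eq (hp v (hne h.symm)).1.symm huv (hp v (hne h.symm)).2 h.symm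

namespace IsParentMap

variable {G : SimpleGraph V} {r : V} {par : V → V}

lemma par_ne_self (h : IsParentMap G r par) {v : V} (hv : v ≠ r) : par v ≠ v :=
  (h.adj hv).ne'

lemma dist_par_le (h : IsParentMap G r par) (v : V) : G.dist r (par v) ≤ G.dist r v := by
  by_cases hv : v = r
  · rw [hv, h.root]
  · have := h.dist hv
    omega

lemma dist_iterate_le (h : IsParentMap G r par) (v : V) (k : ℕ) :
    G.dist r (par^[k] v) ≤ G.dist r v := by
  induction k with
  | zero => rfl
  | succ k ih =>
    rw [Function.iterate_succ_apply']
    exact (h.dist_par_le _).trans ih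

lemma adj_iff (h : IsParentMap G r par) {u v : V} :
    G.Adj u v ↔ u ≠ v ∧ (par u = v ∨ par v = u) := by
  refine ⟨fun huv => ⟨huv.ne, h.eq_or_eq huv⟩, ?_⟩
  rintro ⟨hne, rfl | rfl⟩
  · exact h.adj fun hu => hne (by rw [hu, h.root])
  · exact (h.adj fun hv => hne (by rw [hv, h.root])).symm

lemma eq_par_of_dist (h : IsParentMap G r par) {u v : V} (huv : G.Adj u v)
    (hd : G.dist r u + 1 = G.dist r v) : v ≠ r ∧ u = par v := by
  have hv : v ≠ r := by
    rintro rfl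
    rw [SimpleGraph.dist_self] at hd
    omega
  refine ⟨hv, ?_⟩
  rcases h.eq_or_eq huv with h' | h'
  · have := h.dist_par_le u
    rw [h'] at this
    omega
  · exact h'.symm

/-- In a graph that keeps the edges from the ancestors of `v` to their parents, `v` is joined to
each of its ancestors. -/
lemma reachable_iterate {H : SimpleGraph V} {v : V} {k : ℕ}
    (hH : ∀ i < k, par^[i] v ≠ r → H.Adj (par^[i] v) (par (par^[i] v)))
    (hr : par r = r) : H.Reachable v (par^[k] v) := by
  induction k with
  | zero => exact SimpleGraph.Reachable.refl _
  | succ k ih =>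
    refine (ih fun i hi => hH i (by omega)).trans ?_
    rw [Function.iterate_succ_apply']
    by_cases hv : par^[k] v = r
    · rw [hv, hr]
    · exact (hH k (by omega) hv).reachable

lemma exists_iterate_eq_root (h : IsParentMap G r par) (hG : G.Connected) (v : V) :
    ∃ k, par^[k] v = r := by
  generalize hn : G.dist r v = n
  induction n generalizing v with
  | zero => exact ⟨0, (hG.dist_eq_zero_iff.mp hn).symm⟩
  | succ n ih =>
    have hv : v ≠ r := by
      rintro rfl
      rw [SimpleGraph.dist_self] at hn
      omega
    have := h.dist hv
    obtain ⟨k, hk⟩ := ih (par v) (by omega)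
    exact ⟨k + 1, by rw [Function.iterate_succ_apply, hk]⟩

lemma reachable_root {H : SimpleGraph V} (h : IsParentMap G r par) (hG : G.Connected) {v : V}
    (hH : ∀ i, par^[i] v ≠ r → H.Adj (par^[i] v) (par (par^[i] v))) : H.Reachable v r := by
  obtain ⟨k, hk⟩ := h.exists_iterate_eq_root hG v
  exact hk ▸ reachable_iterate (fun i _ => hH i) h.root

lemma card_fiber_add_one [Fintype V] [DecidableEq V] (h : IsParentMap G r par) (w : V) :
    #{v | par v = w} + 1 = deg G w + if w = r then 2 else 0 := by
  classical
  have hdeg : deg G w = #(G.neighborFinset w) := by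
    rw [deg, ← SimpleGraph.card_neighborFinset_eq_degree]
  rw [hdeg]
  split_ifs with hw
  · subst hw
    have : ({v | par v = w} : Finset V) = insert w (G.neighborFinset w) := by
      ext v
      simp only [Finset.mem_filter, Finset.mem_univ, true_and, Finset.mem_insert,
        SimpleGraph.mem_neighborFinset, h.adj_iff, h.root]
      by_cases hv : v = w
      · simp [hv, h.root]
      · simp [hv, Ne.symm hv]
    rw [this, Finset.card_insert_of_notMem (by simp)]
  · have : G.neighborFinset w = insert (par w) ({v | par v = w} : Finset V) := by
      ext v
      simp only [Finset.mem_filter, Finset.mem_univ, true_and, Finset.mem_insert,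
        SimpleGraph.mem_neighborFinset, h.adj_iff]
      have hpw := h.par_ne_self hw
      have hvv : v = w → par v ≠ w := by
        rintro rfl
        exact hpw
      grind
    rw [this, Finset.card_insert_of_notMem]
    · simp only [Finset.mem_filter, Finset.mem_univ, true_and]
      intro hpp
      have h1 := h.dist hw
      have h2 := h.dist_par_le (par w)
      rw [hpp] at h2
      omega

end IsParentMap

lemma SimpleGraph.Connected.of_forall_adj_reachable {G H : SimpleGraph V} (hG : G.Connected)
    (h : ∀ u v, G.Adj u v → H.Reachable u v) : H.Connected := by
  have := hG.nonempty
  refine ⟨fun u v => ?_⟩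
  obtain ⟨p⟩ := hG u v
  induction p with
  | nil => exact SimpleGraph.Reachable.refl _
  | cons hadj _ ih => exact (h _ _ hadj).trans ih

lemma switched_adj_of_adj {G : SimpleGraph V} {a b c d x y : V} (h : G.Adj x y)
    (h1 : s(x, y) ≠ s(a, b)) (h2 : s(x, y) ≠ s(c, d)) : (switched G a b c d).Adj x y := by
  rw [switched, SimpleGraph.fromEdgeSet_adj]
  exact ⟨Or.inl ⟨h, by simp [h1, h2]⟩, h.ne⟩

lemma connected_switched {G : SimpleGraph V} (hG : G.Connected) {a b c d : V} (hac : a ≠ c)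
    (hbd : b ≠ d) (h : (switched G a b c d).Reachable a d ∨ (switched G a b c d).Reachable b c) :
    (switched G a b c d).Connected := by
  have h1 : (switched G a b c d).Reachable a c := by
    refine SimpleGraph.Adj.reachable ?_
    rw [switched, SimpleGraph.fromEdgeSet_adj]
    exact ⟨by simp, hac⟩
  have h2 : (switched G a b c d).Reachable b d := by
    refine SimpleGraph.Adj.reachable ?_
    rw [switched, SimpleGraph.fromEdgeSet_adj]
    exact ⟨by simp, hbd⟩
  have hab : (switched G a b c d).Reachable a b := by
    rcases h with h | h
    · exact h.trans h2.symm
    · exact h1.trans h.symm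
  have hcd : (switched G a b c d).Reachable c d := (h1.symm.trans hab).trans h2
  refine hG.of_forall_adj_reachable fun x y hxy => ?_
  by_cases e1 : s(x, y) = s(a, b)
  · rcases Sym2.eq_iff.mp e1 with ⟨rfl, rfl⟩ | ⟨rfl, rfl⟩
    exacts [hab, hab.symm]
  by_cases e2 : s(x, y) = s(c, d)
  · rcases Sym2.eq_iff.mp e2 with ⟨rfl, rfl⟩ | ⟨rfl, rfl⟩
    exacts [hcd, hcd.symm]
  exact (switched_adj_of_adj hxy e1 e2).reachable

lemma isTree_of_connected_of_degMultiset_eq [Fintype V] {G H : SimpleGraph V} (hG : G.IsTree)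
    (hH : H.Connected) (h : degMultiset H = degMultiset G) : H.IsTree := by
  classical
  have hsum : ∀ K : SimpleGraph V, (degMultiset K).sum = 2 * Nat.card K.edgeSet := by
    intro K
    rw [Nat.card_eq_fintype_card, ← SimpleGraph.edgeFinset_card,
      ← SimpleGraph.sum_degrees_eq_twice_card_edges]
    refine Finset.sum_congr rfl fun v _ => ?_
    unfold deg
    congr!
  rw [SimpleGraph.isTree_iff_connected_and_card] at hG ⊢
  have h1 := hsum G
  rw [← h, hsum H] at h1
  exact ⟨hH, by omega⟩

end Rooting

section Ordering

lemma exists_equiv_fin_lt_iff [Fintype V] {L : Type*} [LinearOrder L] {k : V → L}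
    (hk : Function.Injective k) :
    ∃ ord : V ≃ Fin (Fintype.card V), ∀ u v, ord u < ord v ↔ k u < k v := by
  let := LinearOrder.lift' k hk
  refine ⟨(monoEquivOfFin V rfl).symm.toEquiv, fun u v => ?_⟩
  exact (monoEquivOfFin V rfl).symm.lt_iff_lt

lemma exists_equiv_fin_antitone [Fintype V] (f : V → ℝ) :
    ∃ e : V ≃ Fin (Fintype.card V), ∀ u v, e u ≤ e v → f v ≤ f u := by
  obtain ⟨e, he⟩ := exists_equiv_fin_lt_iff (k := fun v => toLex (-f v, Fintype.equivFin V v))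
    (fun u v h => by simpa using (Prod.ext_iff.mp (toLex.injective h)).2)
  refine ⟨e, fun u v huv => ?_⟩
  by_contra! hlt
  refine absurd ((he v u).mpr ?_) huv.not_gt
  rw [Prod.Lex.toLex_lt_toLex]
  exact Or.inl (neg_lt_neg hlt)

lemma deg_pos_of_adj [Fintype V] {G : SimpleGraph V} {u v : V} (h : G.Adj u v) : 0 < deg G u := by
  classical
  rw [deg, SimpleGraph.degree_pos_iff_exists_adj]
  exact ⟨v, h⟩

lemma lt_of_deg_lt_of_specRad_max [Fintype V] [DecidableEq V] {G : SimpleGraph V} (hG : G.IsTree)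
    (hmax : ∀ H : SimpleGraph V, H.Connected → degMultiset H = degMultiset G →
      specRad H ≤ specRad G)
    {f : V → ℝ} (hf : IsPerronVector G f) {u v : V} (h : deg G v < deg G u) : f v < f u := by
  by_contra! hle
  have := hG.connected.nonempty
  have huv : u ≠ v := by
    rintro rfl
    exact h.false
  obtain ⟨par, hp⟩ := hG.exists_isParentMap v
  obtain ⟨y, hy, -⟩ := hG.connected.exists_adj_dist_add_one huv.symm
  have hpos := deg_pos_of_adj hy
  have hC := hp.card_fiber_add_one u
  rw [if_neg huv] at hC
  obtain ⟨S, hSC, hScard⟩ := Finset.exists_subset_card_eq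
    (show deg G u - deg G v ≤ #{w | par w = u} by omega)
  have hSpar : ∀ s ∈ S, par s = u := fun s hs => by simpa using hSC hs
  have hvS : v ∉ S := fun hv => huv (by rw [← hSpar v hv, hp.root])
  have hS : S.Nonempty := Finset.card_pos.mp (by omega)
  have hSne : ∀ s ∈ S, s ≠ v := fun s hs hsv => hvS (hsv ▸ hs)
  have hu : ∀ s ∈ S, G.Adj u s := fun s hs => by
    have := (hp.adj (hSne s hs)).symm
    rwa [hSpar s hs] at this
  have hnadj : ∀ s ∈ S, ¬ G.Adj v s := fun s hs hadj => by
    rcases hp.eq_or_eq hadj with h | h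
    · exact hSne s hs (by rw [← h, hp.root])
    · exact huv (by rw [← hSpar s hs, h])
  refine (specRad_lt_specRad_shiftedSet hvS huv hu hnadj hS hf hle).not_ge (hmax _ ?_
    (degMultiset_shiftedSet hvS huv hu hnadj (by omega)))
  have hreach : (shiftedSet G u v S hvS).Reachable u v := by
    refine hp.reachable_root hG.connected fun i hi => Or.inl ⟨hp.adj hi, ?_, ?_⟩
    · rintro ⟨h1, h2⟩
      have h3 := hp.dist hi
      have h4 := hp.dist_par_le (par (par^[i] u))
      rw [hSpar _ h2, h1] at h4
      rw [h1] at h3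
      omega
    · rintro ⟨h1, h2⟩
      have h3 := hp.dist hi
      have h4 := hp.dist_iterate_le u i
      rw [h1] at h3
      omega
  have hvs : ∀ s ∈ S, (shiftedSet G u v S hvS).Reachable v s := fun s hs =>
    SimpleGraph.Adj.reachable (Or.inr (Or.inl ⟨rfl, hs⟩))
  refine hG.connected.of_forall_adj_reachable fun x y hxy => ?_
  by_cases h1 : x = u ∧ y ∈ S
  · exact h1.1 ▸ hreach.trans (hvs y h1.2)
  by_cases h2 : y = u ∧ x ∈ S
  · exact h2.1 ▸ (hreach.trans (hvs x h2.2)).symm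
  exact SimpleGraph.Adj.reachable (Or.inl ⟨hxy, h1, h2⟩)

/-- A numerical key along which the vertices are listed in breadth-first order, with siblings
listed by increasing value of `e`: it reads the values of `e` along the path from the root as
digits. -/
lemma IsParentMap.exists_key {G : SimpleGraph V} {r : V} {par : V → V} (h : IsParentMap G r par)
    (N : ℕ) (e : V → ℕ) :
    ∃ key : V → ℕ, key r = 0 ∧ ∀ v, v ≠ r → key v = N * key (par v) + e v := by
  let K : ℕ → V → ℕ := Nat.rec (fun _ => 0) fun _ k v => N * k (par v) + e v
  refine ⟨fun v => K (G.dist r v) v, by simp [K], fun v hv => ?_⟩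
  dsimp only
  rw [← h.dist hv]

section Key

variable {G : SimpleGraph V} {r : V} {par : V → V} {N : ℕ} {e key : V → ℕ}

lemma IsParentMap.key_lt_pow (h : IsParentMap G r par) (he : ∀ v, e v < N) (hkr : key r = 0)
    (hk : ∀ v, v ≠ r → key v = N * key (par v) + e v) (v : V) : key v < N ^ G.dist r v := by
  generalize hn : G.dist r v = n
  induction n generalizing v with
  | zero =>
    have hv : v = r := by
      by_contra hv
      have := h.dist hv
      omega
    simp [hv, hkr]
  | succ n ih =>
    have hv : v ≠ r := by
      rintro rfl
      simp at hn
    have hd := h.dist hv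
    have := ih (par v) (by omega)
    rw [hk v hv, pow_succ']
    have := Nat.mul_le_mul_left N (Nat.succ_le_of_lt this)
    rw [Nat.succ_eq_add_one, mul_add, mul_one] at this
    have := he v
    omega

lemma IsParentMap.pow_le_key (h : IsParentMap G r par) (he : ∀ v, v ≠ r → 0 < e v)
    (hk : ∀ v, v ≠ r → key v = N * key (par v) + e v) {v : V} (hv : v ≠ r) :
    N ^ (G.dist r v - 1) ≤ key v := by
  generalize hn : G.dist r v - 1 = n
  induction n generalizing v with
  | zero =>
    rw [hk v hv]
    have := he v hv
    simp only [pow_zero]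
    omega
  | succ n ih =>
    have hd := h.dist hv
    have hpv : par v ≠ r := by
      intro hpv
      rw [hpv, SimpleGraph.dist_self] at hd
      omega
    have := ih hpv (by omega)
    rw [hk v hv, pow_succ']
    exact (Nat.mul_le_mul_left N this).trans (Nat.le_add_right _ _)

lemma IsParentMap.dist_le_of_key_le (h : IsParentMap G r par) (he : ∀ v, e v < N)
    (he0 : ∀ v, v ≠ r → 0 < e v) (hkr : key r = 0)
    (hk : ∀ v, v ≠ r → key v = N * key (par v) + e v) {u v : V} (huv : key u ≤ key v) :
    G.dist r u ≤ G.dist r v := by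
  by_contra! hlt
  have hu : u ≠ r := by
    rintro rfl
    simp at hlt
  have h1 := h.key_lt_pow he hkr hk v
  have h2 := h.pow_le_key he0 hk hu
  have hN : 0 < N := (Nat.zero_le _).trans_lt (he u)
  have h3 := Nat.pow_le_pow_right hN (show G.dist r v ≤ G.dist r u - 1 by omega)
  omega

end Key

lemma le_of_key_lt_of_specRad_max [Fintype V] [DecidableEq V] {G : SimpleGraph V} (hG : G.IsTree)
    (hmax : ∀ H : SimpleGraph V, H.Connected → degMultiset H = degMultiset G →
      specRad H ≤ specRad G)
    {f : V → ℝ} (hf : IsPerronVector G f) {r : V} (hr : ∀ v, f v ≤ f r) {par : V → V}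
    (hp : IsParentMap G r par) {key : V → ℕ} (hinj : Function.Injective key) (hkr : key r = 0)
    (hdist : ∀ {u v}, key u ≤ key v → G.dist r u ≤ G.dist r v)
    (hpar : ∀ {u v}, u ≠ r → v ≠ r → key u < key v → key (par u) ≤ key (par v))
    (hsib : ∀ {u v}, u ≠ r → v ≠ r → par u = par v → key u < key v → f v ≤ f u)
    {u v : V} (huv : key u < key v) : f v ≤ f u := by
  have := hG.connected.nonempty
  induction hn : key u using Nat.strong_induction_on generalizing u v with
  | _ n ih =>
  subst hn
  by_contra! hlt
  have hu : u ≠ r := by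
    rintro rfl
    exact (hr v).not_gt hlt
  have hv : v ≠ r := by
    rintro rfl
    omega
  have hdu := hp.dist hu
  have hdv := hp.dist hv
  have hduv := hdist huv.le
  have hpar_lt : ∀ {x}, x ≠ r → key (par x) < key x := fun {x} hx => by
    by_contra! hle
    have := hdist hle
    have := hp.dist hx
    omega
  have hkpar : key (par u) < key (par v) := by
    refine lt_of_le_of_ne (hpar hu hv huv) fun heq => ?_
    exact (hsib hu hv (hinj heq) huv).not_gt hlt
  have hne : par u ≠ par v := fun h => hkpar.ne (congrArg key h)
  have hdpar := hdist hkpar.le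
  have huadj := (hp.adj hu).symm
  have hac : par u ≠ v := by
    intro h
    rw [h] at hdu
    omega
  have hac' : ¬ G.Adj (par u) v := by
    intro hadj
    rcases hp.eq_or_eq hadj with h | h
    · have := hp.dist_par_le (par u)
      rw [h] at this
      omega
    · exact hne h.symm
  by_cases hanc : ∃ k, par^[k] (par v) = u
  · obtain ⟨k, hk⟩ := hanc
    have hchild : ∃ c, c ≠ r ∧ par c = u := by
      refine ⟨par^[k] v, fun hkr => hu ?_, ?_⟩
      · rw [← hk, ← Function.iterate_succ_apply, Function.iterate_succ_apply', hkr, hp.root]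
      · rw [← Function.iterate_succ_apply' par, Function.iterate_succ_apply, hk]
    obtain ⟨c, hcr, hcu⟩ := hchild
    have hdeg : deg G u ≤ deg G v := by
      by_contra! hd
      exact hlt.not_gt (lt_of_deg_lt_of_specRad_max hG hmax hf hd)
    have hcu' := hp.card_fiber_add_one u
    have hcv' := hp.card_fiber_add_one v
    rw [if_neg hu] at hcu'
    rw [if_neg hv] at hcv'
    have hcpos : 0 < #{w | par w = u} := Finset.card_pos.mpr ⟨c, by simpa using hcu⟩
    obtain ⟨x, hx⟩ : ({w | par w = v} : Finset V).Nonempty := Finset.card_pos.mp (by omega)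
    have hxv : par x = v := by simpa using hx
    have hxr : x ≠ r := by
      rintro rfl
      exact hv (by rw [← hxv, hp.root])
    have hdx := hp.dist hxr
    have hkx := hpar_lt hxr
    rw [hxv] at hdx hkx
    have hvx : G.Adj v x := by
      have := (hp.adj hxr).symm
      rwa [hxv] at this
    have hbd : u ≠ x := by
      rintro rfl
      omega
    have hbd' : ¬ G.Adj u x := by
      intro hadj
      rcases hp.eq_or_eq hadj with h | h
      · rw [h] at hdu
        omega
      · rw [hxv] at h
        rw [h] at huv
        omega
    have hxw : f x ≤ f (par u) :=
      ih (key (par u)) (hpar_lt hu) (by have := hpar_lt hu; omega) rfl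
    refine (specRad_lt_specRad_switched huadj hvx hac hbd hac' hbd' hf hxw hlt).not_ge
      (hmax _ (connected_switched hG.connected hac hbd (Or.inr ?_))
        (degMultiset_switched huadj hvx hac hbd hac' hbd'))
    have hex : ∃ k, par^[k] v = u := ⟨k + 1, by rw [Function.iterate_succ_apply, hk]⟩
    have hmin := fun m => Nat.find_min hex (m := m)
    have hspec := Nat.find_spec hex
    suffices hreach : (switched G (par u) u v x).Reachable v (par^[Nat.find hex] v) by
      rw [hspec] at hreach
      exact hreach.symm
    refine IsParentMap.reachable_iterate (fun i hi hir => ?_) hp.root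
    have hdi := hp.dist hir
    have hdi' := hp.dist_iterate_le v i
    have hiu := hmin i hi
    refine switched_adj_of_adj (hp.adj hir) ?_ ?_
    · intro h
      rcases Sym2.eq_iff.mp h with ⟨h1, h2⟩ | ⟨h1, h2⟩
      · rw [h2, h1] at hdi
        omega
      · exact hiu h1
    · intro h
      rcases Sym2.eq_iff.mp h with ⟨h1, h2⟩ | ⟨h1, h2⟩
      · rw [h2, h1] at hdi
        omega
      · rw [h1] at hdi'
        omega
  · have hbd : u ≠ par v := fun h => hanc ⟨0, h.symm⟩
    have hvadj := hp.adj hv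
    have hbd' : ¬ G.Adj u (par v) := by
      intro hadj
      rcases hp.eq_or_eq hadj with h | h
      · exact hne h
      · exact hanc ⟨1, h⟩
    have hww : f (par v) ≤ f (par u) := ih (key (par u)) (hpar_lt hu) hkpar rfl
    refine (specRad_lt_specRad_switched huadj hvadj hac hbd hac' hbd' hf hww hlt).not_ge
      (hmax _ (connected_switched hG.connected hac hbd (Or.inl ?_))
        (degMultiset_switched huadj hvadj hac hbd hac' hbd'))
    have hto : ∀ y, G.dist r y ≤ G.dist r (par v) → (∀ i, par^[i] y ≠ u) →
        (switched G (par u) u v (par v)).Reachable y r := by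
      intro y hy hyu
      refine hp.reachable_root hG.connected fun i hir => ?_
      have hdi := hp.dist hir
      have hdi' := hp.dist_iterate_le y i
      refine switched_adj_of_adj (hp.adj hir) ?_ ?_
      · intro h
        rcases Sym2.eq_iff.mp h with ⟨h1, h2⟩ | ⟨h1, h2⟩
        · rw [h2, h1] at hdi
          omega
        · exact hyu i h1
      · intro h
        rcases Sym2.eq_iff.mp h with ⟨h1, h2⟩ | ⟨h1, h2⟩
        · rw [h1] at hdi'
          omega
        · rw [h2, h1] at hdi
          omega
    refine (hto (par u) hdpar fun i hi => ?_).trans (hto (par v) le_rfl fun i hi => ?_).symm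
    · have := hp.dist_iterate_le (par u) i
      rw [hi] at this
      omega
    · exact hanc ⟨i, hi⟩

theorem exists_isBFDOrdering_of_specRad_max [Fintype V] [DecidableEq V] [Nonempty V]
    {G : SimpleGraph V} (hG : G.IsTree)
    (hmax : ∀ H : SimpleGraph V, H.Connected → degMultiset H = degMultiset G →
      specRad H ≤ specRad G)
    {f : V → ℝ} (hf : IsPerronVector G f) :
    ∃ ord : V ≃ Fin (Fintype.card V), IsBFDOrdering G ord ∧
      ∀ u v : V, f v < f u → ord u < ord v := by
  obtain ⟨e, he⟩ := exists_equiv_fin_antitone f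
  set r := e.symm ⟨0, Fintype.card_pos⟩ with hr
  have her : e r = ⟨0, Fintype.card_pos⟩ := by simp [hr]
  have he0 : ∀ v, v ≠ r → 0 < (e v : ℕ) := by
    intro v hv
    refine Nat.pos_of_ne_zero fun h => hv (e.injective ?_)
    rw [her]
    exact Fin.ext h
  obtain ⟨par, hp⟩ := hG.exists_isParentMap r
  obtain ⟨key, hkr, hk⟩ := hp.exists_key (Fintype.card V) (fun v => e v)
  have hmod : ∀ v, key v % Fintype.card V = e v := by
    intro v
    by_cases hv : v = r
    · simp [hv, hkr, her]
    · rw [hk v hv, Nat.mul_add_mod, Nat.mod_eq_of_lt (e v).2]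
  have hinj : Function.Injective key := by
    intro u v huv
    apply e.injective
    rw [Fin.ext_iff, ← hmod, ← hmod, huv]
  have hdist : ∀ {u v}, key u ≤ key v → G.dist r u ≤ G.dist r v := fun h =>
    hp.dist_le_of_key_le (fun v => (e v).2) he0 hkr hk h
  have hparlt : ∀ {u v}, u ≠ r → v ≠ r → key (par u) < key (par v) → key u < key v := by
    intro u v hu hv h
    rw [hk u hu, hk v hv]
    have h1 := Nat.mul_le_mul_left (Fintype.card V) (Nat.succ_le_of_lt h)
    rw [Nat.succ_eq_add_one, mul_add, mul_one] at h1
    have := (e u).2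
    omega
  have hmono : ∀ {u v}, key u < key v → f v ≤ f u := by
    intro u v huv
    refine le_of_key_lt_of_specRad_max hG hmax hf (fun v => he r v ?_) hp hinj hkr hdist ?_ ?_ huv
    · rw [her]
      exact Nat.zero_le _
    · intro u v hu hv h
      by_contra! hlt
      exact h.not_gt (hparlt hv hu hlt)
    · intro u v hu hv h hlt
      rw [hk u hu, hk v hv, h] at hlt
      exact he u v (by rw [Fin.le_def]; omega)
  obtain ⟨ord, hord⟩ := exists_equiv_fin_lt_iff hinj
  have hroot : ord.symm ⟨0, Fintype.card_pos⟩ = r := by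
    rw [Equiv.symm_apply_eq]
    by_contra hne
    have hlt : (⟨0, Fintype.card_pos⟩ : Fin (Fintype.card V)) < ord r :=
      lt_of_le_of_ne (Nat.zero_le _) hne
    rw [← ord.apply_symm_apply ⟨0, Fintype.card_pos⟩, hord, hkr] at hlt
    exact Nat.not_lt_zero _ hlt
  refine ⟨ord, ⟨?_, ?_, ?_⟩, ?_⟩
  · intro u v huv
    rw [hroot]
    exact hdist (not_lt.mp fun h => huv.not_gt ((hord v u).mpr h))
  · intro w1 w2 v1 v2 hw h1 h2
    rw [IsParent, hroot] at h1 h2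
    obtain ⟨hv1, rfl⟩ := hp.eq_par_of_dist h1.1 h1.2.1
    obtain ⟨hv2, rfl⟩ := hp.eq_par_of_dist h2.1 h2.2.1
    rw [hord] at hw ⊢
    exact hparlt hv1 hv2 hw
  · intro u v huv
    by_contra! hlt
    exact (hmono ((hord u v).mp huv)).not_gt (lt_of_deg_lt_of_specRad_max hG hmax hf hlt)
  · intro u v huv
    by_contra! hle
    rcases hle.lt_or_eq with h | h
    · exact (hmono ((hord v u).mp h)).not_gt huv
    · rw [ord.injective h] at huv
      exact huv.false

end Ordering

section Uniqueness

lemma Monotone.eq_of_map_univ_eq {α : Type*} [PartialOrder α] {n : ℕ} {a b : Fin n → α}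
    (ha : Monotone a) (hb : Monotone b)
    (h : (Finset.univ.val.map a : Multiset α) = Finset.univ.val.map b) : a = b := by
  refine List.ofFn_injective (List.Perm.eq_of_pairwise' ha.sortedLE_ofFn.pairwise
    hb.sortedLE_ofFn.pairwise ?_)
  rw [← Multiset.coe_eq_coe]
  simpa [Fin.univ_val_map] using h

lemma IsParentMap.isParent [Fintype V] [Nonempty V] {G : SimpleGraph V}
    {ord : V ≃ Fin (Fintype.card V)} {par : V → V}
    (h : IsParentMap G (ord.symm ⟨0, Fintype.card_pos⟩) par) {v : V}
    (hv : v ≠ ord.symm ⟨0, Fintype.card_pos⟩) : IsParent G ord (par v) v :=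
  ⟨(h.adj hv).symm, h.dist hv, fun w hw hd => by rw [(h.eq_par_of_dist hw hd).2]⟩

lemma IsBFDOrdering.monotone_par [Fintype V] [Nonempty V] {G : SimpleGraph V}
    {ord : V ≃ Fin (Fintype.card V)} (hord : IsBFDOrdering G ord) {par : V → V}
    (h : IsParentMap G (ord.symm ⟨0, Fintype.card_pos⟩) par) :
    Monotone fun i => ord (par (ord.symm i)) := by
  intro i j hij
  dsimp only
  by_cases hi : i = ⟨0, Fintype.card_pos⟩
  · rw [hi, h.root, Equiv.apply_symm_apply]
    exact Nat.zero_le _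
  by_cases hj : j = ⟨0, Fintype.card_pos⟩
  · exact absurd (Fin.ext (Nat.le_zero.mp (show (i : ℕ) ≤ 0 by rw [hj] at hij; exact hij))) hi
  by_contra! hlt
  have := hord.2.1 _ _ _ _ hlt (h.isParent (ord.symm.injective.ne hj))
    (h.isParent (ord.symm.injective.ne hi))
  simp only [Equiv.apply_symm_apply] at this
  exact hij.not_gt this

theorem IsBFDOrdering.nonempty_iso [Fintype V] [DecidableEq V] [Nonempty V] {G H : SimpleGraph V}
    (hG : G.IsTree) (hH : H.IsTree) (hdeg : degMultiset G = degMultiset H)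
    {ordG ordH : V ≃ Fin (Fintype.card V)} (hordG : IsBFDOrdering G ordG)
    (hordH : IsBFDOrdering H ordH) : Nonempty (G ≃g H) := by
  have hmono : ∀ {K : SimpleGraph V} {ord : V ≃ Fin (Fintype.card V)}, IsBFDOrdering K ord →
      Monotone fun i => OrderDual.toDual (deg K (ord.symm i)) := by
    intro K ord hord i j hij
    rcases hij.lt_or_eq with h | rfl
    · exact OrderDual.toDual_le_toDual.mpr
        (hord.2.2 (ord.symm i) (ord.symm j) (by simpa using h))
    · exact le_rfl
  have hmap : ∀ (K : SimpleGraph V) (ord : V ≃ Fin (Fintype.card V)),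
      (Finset.univ.val.map fun i => OrderDual.toDual (deg K (ord.symm i))) =
        (degMultiset K).map OrderDual.toDual := by
    intro K ord
    rw [degMultiset, ← Multiset.map_univ_val_equiv ord.symm, Multiset.map_map, Multiset.map_map]
    rfl
  have hdeg' : ∀ i, deg G (ordG.symm i) = deg H (ordH.symm i) := fun i =>
    OrderDual.toDual.injective (congrFun ((hmono hordG).eq_of_map_univ_eq (hmono hordH)
      (by rw [hmap, hmap, hdeg])) i)
  obtain ⟨pG, hpG⟩ := hG.exists_isParentMap (ordG.symm ⟨0, Fintype.card_pos⟩)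
  obtain ⟨pH, hpH⟩ := hH.exists_isParentMap (ordH.symm ⟨0, Fintype.card_pos⟩)
  have hcount : ∀ {K : SimpleGraph V} {ord : V ≃ Fin (Fintype.card V)} {p : V → V},
      IsParentMap K (ord.symm ⟨0, Fintype.card_pos⟩) p → ∀ i,
      (Finset.univ.val.map fun j => ord (p (ord.symm j))).count i + 1 =
        deg K (ord.symm i) + if i = ⟨0, Fintype.card_pos⟩ then 2 else 0 := by
    intro K ord p hp i
    have h := hp.card_fiber_add_one (ord.symm i)
    simp only [ord.symm.injective.eq_iff] at h
    rw [← h, Multiset.count_map, ← Finset.filter_val, Finset.card_val]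
    congr 1
    refine Finset.card_equiv ord.symm fun j => ?_
    simp only [Finset.mem_filter, Finset.mem_univ, true_and]
    rw [Equiv.eq_symm_apply, eq_comm]
  have hpar : (fun i => ordG (pG (ordG.symm i))) = fun i => ordH (pH (ordH.symm i)) := by
    refine (hordG.monotone_par hpG).eq_of_map_univ_eq (hordH.monotone_par hpH)
      (Multiset.ext.mpr fun i => ?_)
    have h1 := hcount hpG i
    have h2 := hcount hpH i
    rw [hdeg' i, ← h2] at h1
    exact Nat.succ_injective h1
  have hcomm : ∀ v, pH (ordH.symm (ordG v)) = ordH.symm (ordG (pG v)) := by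
    intro v
    have := congrFun hpar (ordG v)
    simp only [Equiv.symm_apply_apply] at this
    rw [this, Equiv.symm_apply_apply]
  refine ⟨⟨ordG.trans ordH.symm, fun {u v} => ?_⟩⟩
  rw [hpH.adj_iff, hpG.adj_iff]
  simp only [Equiv.trans_apply, hcomm, ordH.symm.injective.eq_iff, ordG.injective.eq_iff, ne_eq]

end Uniqueness

/-- A tree `G` with tree degree sequence `d` has greatest spectral
radius among all trees with degree sequence `d` iff it admits a BFD-ordering;
moreover such a BFD-ordering is consistent with the Perron vector `f` of `G`. -/
theorem tree_max_spectral_radius_iff_bfd [Fintype V] [DecidableEq V] [Nonempty V]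
    {n : ℕ} (d : Fin n → ℕ) (hd : IsTreeDegSeq d)
    (G : SimpleGraph V) (hG : G.IsTree) (hGd : hasDegSeq G d)
    (f : V → ℝ) (hf : IsPerronVector G f) :
    ((∀ H : SimpleGraph V, H.IsTree → hasDegSeq H d → specRad H ≤ specRad G) ↔
      ∃ ord : V ≃ Fin (Fintype.card V), IsBFDOrdering G ord) ∧
    ((∀ H : SimpleGraph V, H.IsTree → hasDegSeq H d → specRad H ≤ specRad G) →
      ∃ ord : V ≃ Fin (Fintype.card V), IsBFDOrdering G ord ∧
        ∀ u v : V, f v < f u → ord u < ord v) := by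
  have hiff : ∀ H : SimpleGraph V, hasDegSeq H d ↔ degMultiset H = degMultiset G := fun H => by
    rw [hasDegSeq, show Finset.univ.val.map d = degMultiset G from hGd, eq_comm]
  have hbfd : ∀ K : SimpleGraph V, K.IsTree → degMultiset K = degMultiset G →
      (∀ H : SimpleGraph V, H.IsTree → hasDegSeq H d → specRad H ≤ specRad K) →
      ∀ g, IsPerronVector K g → ∃ ord : V ≃ Fin (Fintype.card V), IsBFDOrdering K ord ∧
        ∀ u v : V, g v < g u → ord u < ord v := fun K hK hKd hmax g hg =>
    exists_isBFDOrdering_of_specRad_max hK (fun H hH hHd =>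
      hmax H (isTree_of_connected_of_degMultiset_eq hK hH hHd) ((hiff H).mpr (hHd.trans hKd))) hg
  refine ⟨⟨fun hmax => ?_, ?_⟩, fun hmax => hbfd G hG rfl hmax f hf⟩
  · obtain ⟨ord, hord, -⟩ := hbfd G hG rfl hmax f hf
    exact ⟨ord, hord⟩
  · rintro ⟨ord, hord⟩ H hH hHd
    obtain ⟨K, ⟨hK, hKd⟩, hKmax⟩ := Set.exists_max_image
      {K : SimpleGraph V | K.IsTree ∧ hasDegSeq K d} specRad (Set.toFinite _) ⟨G, hG, hGd⟩
    have hKG := (hiff K).mp hKd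
    obtain ⟨g, hg⟩ := exists_isPerronVector K hK.connected
    obtain ⟨ordK, hordK, -⟩ := hbfd K hK hKG (fun L hL hLd => hKmax L ⟨hL, hLd⟩) g hg
    obtain ⟨e⟩ := hord.nonempty_iso hG hK hKG.symm hordK
    exact (hKmax H ⟨hH, hHd⟩).trans (specRad_le_of_iso e hg)
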